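/- arXiv:2605.04623 — 2 statements merged into one kernel-verified Lean document; each statement's English description precedes it below -/
import Mathlib

section
/- (SDR tightness, constructive form.) Suppose (V_1,…,V_K, V̄) is relaxed-feasible. Then for every k one has h_k^H V_k h_k ≥ σ_k²/(1+Γ_k) > 0, so the reconstructed matrices V_k'' = v_k''(v_k'')^H with v_k'' = (h_k^H V_k h_k)^{-1/2} · (V_k h_k) are well defined. The tuple (V_1'',…,V_K'', V̄) is again relaxed-feasible, each V_k'' is Hermitian PSD of rank exactly 1, and the objective value Re Tr(E V̄) and the power values Re Tr(A_m V̄) are unchanged. -/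
open Matrix
open scoped ComplexOrder

/-- A tuple `(V₁, …, V_K, V̄)` is relaxed-feasible for the SDR of problem P2:
all matrices are Hermitian PSD, the per-user linearized SINR constraints
`(1+Γ_k)·(h_k^H V_k h_k) − h_k^H V̄ h_k ≥ σ_k²` hold, and the per-AP power
constraints `Re Tr(A_m V̄) ≤ P_m` hold. -/
def RelaxedFeasible {n K M : ℕ}
    (h : Fin K → (Fin n → ℂ)) (Γ : Fin K → ℝ) (σsq : Fin K → ℝ)
    (A : Fin M → Matrix (Fin n) (Fin n) ℂ) (P : Fin M → ℝ)
    (V : Fin K → Matrix (Fin n) (Fin n) ℂ)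
    (Vbar : Matrix (Fin n) (Fin n) ℂ) : Prop :=
  (∀ k, (V k).PosSemidef) ∧ Vbar.PosSemidef ∧
    (∀ k, σsq k ≤
      (1 + Γ k) * (star (h k) ⬝ᵥ (V k) *ᵥ h k).re - (star (h k) ⬝ᵥ Vbar *ᵥ h k).re) ∧
    (∀ m, ((A m * Vbar).trace).re ≤ P m)

/-- The quadratic form of a rank-one matrix `v vᴴ` at `x` is `(xᴴ v) (xᴴ v)ᴴ`. -/
lemma star_dotProduct_vecMulVec_self_star_mulVec {n : ℕ} (x v : Fin n → ℂ) :
    star x ⬝ᵥ vecMulVec v (star v) *ᵥ x = (star x ⬝ᵥ v) * star (star x ⬝ᵥ v) := by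
  rw [vecMulVec_mulVec, dotProduct_smul, ← star_dotProduct v x]
  simp

/-- A rank-one matrix `v vᴴ` built from a nonzero vector has rank exactly one. -/
lemma rank_vecMulVec_self_star {n : ℕ} {v : Fin n → ℂ} (hv : v ≠ 0) :
    (vecMulVec v (star v)).rank = 1 := by
  refine le_antisymm (rank_vecMulVec_le _ _) (Nat.one_le_iff_ne_zero.mpr fun h0 => ?_)
  rw [Matrix.rank, Submodule.finrank_eq_zero, LinearMap.range_eq_bot] at h0
  refine vecMulVec_ne_zero hv (star_ne_zero.mpr hv) (Matrix.ext_of_mulVec_single fun i => ?_)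
  rw [zero_mulVec]
  exact LinearMap.congr_fun h0 (Pi.single i 1)

/-- Normalizing `A x` by the square root of the quadratic form of `A` at `x` gives a vector whose
inner product with `x` is that square root. -/
lemma Matrix.PosSemidef.star_dotProduct_inv_sqrt_smul_mulVec {n : ℕ}
    {A : Matrix (Fin n) (Fin n) ℂ} (hA : A.PosSemidef) (x : Fin n → ℂ) :
    star x ⬝ᵥ (((Real.sqrt ((star x ⬝ᵥ A *ᵥ x).re))⁻¹ : ℂ) • (A *ᵥ x)) =
      (Real.sqrt ((star x ⬝ᵥ A *ᵥ x).re) : ℂ) := by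
  have hre := Complex.eq_re_of_ofReal_le (hA.dotProduct_mulVec_nonneg x)
  rw [dotProduct_smul, smul_eq_mul]
  generalize star x ⬝ᵥ A *ᵥ x = q at hre ⊢
  nth_rewrite 2 [hre]
  rw [← Complex.ofReal_inv, ← Complex.ofReal_mul, inv_mul_eq_div, Real.div_sqrt]

/-- SDR tightness, constructive form: from any relaxed-feasible
tuple, each signal power `h_k^H V_k h_k` is at least `σ_k²/(1+Γ_k) > 0`, so the
rank-one reconstructions `V_k'' = v_k'' (v_k'')^H` with
`v_k'' = (h_k^H V_k h_k)^{-1/2} • (V_k h_k)` are well defined; the tuple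
`(V₁'', …, V_K'', V̄)` is again relaxed-feasible, each `V_k''` is Hermitian PSD
of rank exactly 1, and the objective `Re Tr(E V̄)` and the power values
`Re Tr(A_m V̄)` are unchanged. -/
theorem sdr_tightness_constructive
    {n K M : ℕ}
    (h : Fin K → (Fin n → ℂ)) (Γ : Fin K → ℝ) (hΓ : ∀ k, 0 ≤ Γ k)
    (σsq : Fin K → ℝ) (hσ : ∀ k, 0 < σsq k)
    (A : Fin M → Matrix (Fin n) (Fin n) ℂ) (hA : ∀ m, (A m).PosSemidef)
    (P : Fin M → ℝ) (hP : ∀ m, 0 < P m)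
    (E : Matrix (Fin n) (Fin n) ℂ) (hE : E.PosSemidef)
    (V : Fin K → Matrix (Fin n) (Fin n) ℂ) (Vbar : Matrix (Fin n) (Fin n) ℂ)
    (hfeas : RelaxedFeasible h Γ σsq A P V Vbar)
    (v'' : Fin K → (Fin n → ℂ))
    (hv'' : ∀ k, v'' k =
      ((Real.sqrt ((star (h k) ⬝ᵥ (V k) *ᵥ h k).re))⁻¹ : ℂ) • ((V k) *ᵥ h k))
    (V'' : Fin K → Matrix (Fin n) (Fin n) ℂ)
    (hV'' : ∀ k, V'' k = vecMulVec (v'' k) (star (v'' k))) :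
    (∀ k, σsq k / (1 + Γ k) ≤ (star (h k) ⬝ᵥ (V k) *ᵥ h k).re ∧
        0 < (star (h k) ⬝ᵥ (V k) *ᵥ h k).re) ∧
    RelaxedFeasible h Γ σsq A P V'' Vbar ∧
    (∀ k, (V'' k).PosSemidef ∧ (V'' k).rank = 1) ∧
    ((E * Vbar).trace).re = ((E * Vbar).trace).re ∧
    (∀ m, ((A m * Vbar).trace).re = ((A m * Vbar).trace).re) := by
  obtain ⟨hV, hVbar, hsinr, hpow⟩ := hfeas
  have hpos : ∀ k, 0 < 1 + Γ k := fun k => by linarith [hΓ k]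
  have hbound : ∀ k, σsq k / (1 + Γ k) ≤ (star (h k) ⬝ᵥ (V k) *ᵥ h k).re := fun k => by
    have hnonneg := (Complex.le_def.mp (hVbar.dotProduct_mulVec_nonneg (h k))).1
    rw [Complex.zero_re] at hnonneg
    rw [div_le_iff₀' (hpos k)]
    linarith [hsinr k]
  have hsignal : ∀ k, 0 < (star (h k) ⬝ᵥ (V k) *ᵥ h k).re := fun k =>
    (div_pos (hσ k) (hpos k)).trans_le (hbound k)
  have hinner : ∀ k, star (h k) ⬝ᵥ v'' k =
      (Real.sqrt ((star (h k) ⬝ᵥ (V k) *ᵥ h k).re) : ℂ) := fun k => by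
    rw [hv'' k, (hV k).star_dotProduct_inv_sqrt_smul_mulVec]
  have hpsd : ∀ k, (V'' k).PosSemidef := fun k => by
    rw [hV'' k]
    exact posSemidef_vecMulVec_self_star _
  have hquad : ∀ k, (star (h k) ⬝ᵥ (V'' k) *ᵥ h k).re = (star (h k) ⬝ᵥ (V k) *ᵥ h k).re :=
    fun k => by
      rw [hV'' k, star_dotProduct_vecMulVec_self_star_mulVec, hinner k, Complex.star_def,
        Complex.conj_ofReal, ← Complex.ofReal_mul, Complex.ofReal_re,
        Real.mul_self_sqrt (hsignal k).le]
  have hne : ∀ k, v'' k ≠ 0 := fun k h0 => by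
    have hzero := hinner k
    rw [h0, dotProduct_zero, eq_comm, Complex.ofReal_eq_zero] at hzero
    exact (Real.sqrt_pos.mpr (hsignal k)).ne' hzero
  refine ⟨fun k => ⟨hbound k, hsignal k⟩, ⟨hpsd, hVbar, fun k => ?_, hpow⟩,
    fun k => ⟨hpsd k, ?_⟩, rfl, fun _ => rfl⟩
  · rw [hquad k]
    exact hsinr k
  · rw [hV'' k]
    exact rank_vecMulVec_self_star (hne k)
end

section
/- (SDR tightness, optimal-value form.) The supremum of the objective value Re Tr(E V̄) over all relaxed-feasible tuples (V_1,…,V_K, V̄) equals the supremum of Re Tr(E V̄) over all relaxed-feasible tuples that additionally satisfy rank(V_k) = 1 for every k = 1,…,K. -/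
open Matrix
open scoped ComplexOrder

/-- If the quadratic form of a matrix `V` is positive at `v`, there is a rank-one positive
semidefinite matrix (a multiple of `v vᴴ`) whose quadratic form at `v` has the same value. -/
theorem exists_posSemidef_rank_one_re_quadForm_eq {n : ℕ} (v : Fin n → ℂ)
    (V : Matrix (Fin n) (Fin n) ℂ) (hV : 0 < (star v ⬝ᵥ V *ᵥ v).re) :
    ∃ W : Matrix (Fin n) (Fin n) ℂ, W.PosSemidef ∧ W.rank = 1 ∧
      (star v ⬝ᵥ W *ᵥ v).re = (star v ⬝ᵥ V *ᵥ v).re := by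
  have hv : v ≠ 0 := by
    rintro rfl
    simp at hV
  obtain ⟨s, hs, hvs⟩ : ∃ s : ℝ, 0 < s ∧ star v ⬝ᵥ v = (s : ℂ) := by
    have hpos : 0 < star v ⬝ᵥ v := dotProduct_star_self_pos_iff.mpr hv
    obtain ⟨hre, him⟩ := Complex.pos_iff.mp hpos
    exact ⟨_, hre, Complex.ext rfl (by simpa using him.symm)⟩
  set q := (star v ⬝ᵥ V *ᵥ v).re
  set t : ℝ := Real.sqrt q / s
  have ht : t ≠ 0 := (div_pos (Real.sqrt_pos.mpr hV) hs).ne'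
  have hu : (t : ℂ) • v ≠ 0 := smul_ne_zero (Complex.ofReal_ne_zero.mpr ht) hv
  refine ⟨vecMulVec ((t : ℂ) • v) (star ((t : ℂ) • v)), posSemidef_vecMulVec_self_star _, ?_, ?_⟩
  · refine le_antisymm (rank_vecMulVec_le _ _) (Nat.one_le_iff_ne_zero.mpr ?_)
    rw [Ne, Matrix.rank, Submodule.finrank_eq_zero, LinearMap.range_eq_bot,
      ← Matrix.toLin'_apply', LinearEquiv.map_eq_zero_iff, vecMulVec_eq_zero, star_eq_zero, or_self]
    exact hu
  · have hq : t * s * (t * s) = q := by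
      simp only [t, div_mul_cancel₀ _ hs.ne', Real.mul_self_sqrt hV.le]
    rw [vecMulVec_mulVec, dotProduct_smul, dotProduct_smul, star_smul, smul_dotProduct, hvs]
    simp [← hq]

/-- SDR tightness, optimal-value form: the supremum of the
objective `Re Tr(E V̄)` over relaxed-feasible tuples equals the supremum over
relaxed-feasible tuples whose `V_k` are additionally all of rank one. -/
theorem sdr_tightness_optimal_value
    {n K M : ℕ}
    (h : Fin K → (Fin n → ℂ)) (Γ : Fin K → ℝ) (hΓ : ∀ k, 0 ≤ Γ k)
    (σsq : Fin K → ℝ) (hσ : ∀ k, 0 < σsq k)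
    (A : Fin M → Matrix (Fin n) (Fin n) ℂ) (hA : ∀ m, (A m).PosSemidef)
    (P : Fin M → ℝ) (hP : ∀ m, 0 < P m)
    (E : Matrix (Fin n) (Fin n) ℂ) (hE : E.PosSemidef) :
    sSup {x : ℝ | ∃ (V : Fin K → Matrix (Fin n) (Fin n) ℂ)
        (Vbar : Matrix (Fin n) (Fin n) ℂ),
        RelaxedFeasible h Γ σsq A P V Vbar ∧ x = ((E * Vbar).trace).re} =
    sSup {x : ℝ | ∃ (V : Fin K → Matrix (Fin n) (Fin n) ℂ)
        (Vbar : Matrix (Fin n) (Fin n) ℂ),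
        RelaxedFeasible h Γ σsq A P V Vbar ∧ (∀ k, (V k).rank = 1) ∧
        x = ((E * Vbar).trace).re} := by
  congr 1
  ext x
  constructor
  · rintro ⟨V, Vbar, ⟨_, hVbar, hsinr, hpow⟩, rfl⟩
    have hpos : ∀ k, 0 < (star (h k) ⬝ᵥ V k *ᵥ h k).re := fun k => by
      have hbar : 0 ≤ (star (h k) ⬝ᵥ Vbar *ᵥ h k).re := hVbar.re_dotProduct_nonneg (h k)
      refine pos_of_mul_pos_right (a := 1 + Γ k) ?_ (by linarith [hΓ k])
      linarith [hsinr k, hσ k]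
    choose W hW hrank hquad using fun k =>
      exists_posSemidef_rank_one_re_quadForm_eq (h k) (V k) (hpos k)
    exact ⟨W, Vbar, ⟨hW, hVbar, fun k => by rw [hquad k]; exact hsinr k, hpow⟩, hrank, rfl⟩
  · rintro ⟨V, Vbar, hfeas, _, rfl⟩
    exact ⟨V, Vbar, hfeas, rfl⟩
end
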